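/- Let Δ be an equilateral triangle with unit sides in a Radon plane. Then s(Δ) equals the sum of the distances from any interior point of Δ to the three sides of Δ; in particular this sum is independent of the interior point chosen. -/

import Mathlib

open Module

variable {V : Type*} [NormedAddCommGroup V] [NormedSpace ℝ V]

noncomputable def sine {V : Type*} [NormedAddCommGroup V] [NormedSpace ℝ V] (x y : V) : ℝ :=
  ⨅ t : ℝ, ‖x + t • y‖

def BOrth {V : Type*} [NormedAddCommGroup V] [NormedSpace ℝ V] (x y : V) : Prop :=
  ∀ t : ℝ, ‖x‖ ≤ ‖x + t • y‖

noncomputable def cD (V : Type*) [NormedAddCommGroup V] [NormedSpace ℝ V] : ℝ :=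
  sInf {r : ℝ | ∃ x y : V, ‖x‖ = 1 ∧ ‖y‖ = 1 ∧ BOrth x y ∧ r = sine y x}

noncomputable def cR (V : Type*) [NormedAddCommGroup V] [NormedSpace ℝ V] : ℝ :=
  sSup {r : ℝ | ∃ x y : V, ‖x‖ = 1 ∧ ‖y‖ = 1 ∧ r = |sine x y - sine y x|}

/-- Two positive functions admitting proportional supporting slopes at every point have constant
ratio (one inequality). -/
lemma mul_le_mul_of_common_slope {m n k : ℝ → ℝ} {C : ℝ} (hm : ∀ t, 0 < m t) (hn : ∀ t, 0 < n t)
    (hk : ∀ t, |k t| ≤ C) (hms : ∀ s t, m s * (1 + k s * (t - s)) ≤ m t)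
    (hns : ∀ s t, n s * (1 + k s * (t - s)) ≤ n t) : m 0 * n 1 ≤ m 1 * n 0 := by
  have hC : 0 ≤ C := (abs_nonneg _).trans (hk 0)
  have step : ∀ δ : ℝ, 0 < δ → C * δ < 1 → ∀ i : ℕ,
      m 0 * n (i * δ) * ((1 + k 0 * δ) * (1 - k (i * δ) * δ) * (1 - (C * δ) ^ 2) ^ i)
        ≤ m (i * δ) * n 0 := by
    intro δ hδ hCδ
    have hkδ : ∀ t, |k t * δ| ≤ C * δ := fun t => by
      rw [abs_mul, abs_of_pos hδ]
      exact mul_le_mul_of_nonneg_right (hk t) hδ.le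
    have hpos : ∀ t, 0 < 1 + k t * δ := fun t => by linarith [(abs_le.1 (hkδ t)).1]
    have hneg : ∀ t, 0 < 1 - k t * δ := fun t => by linarith [(abs_le.1 (hkδ t)).2]
    have hsq : ∀ t, (k t * δ) ^ 2 ≤ (C * δ) ^ 2 := fun t => sq_le_sq' (abs_le.1 (hkδ t)).1
      (abs_le.1 (hkδ t)).2
    have hP : 0 ≤ 1 - (C * δ) ^ 2 := by nlinarith [mul_nonneg hC hδ.le]
    intro i
    induction i with
    | zero =>
      simp only [Nat.cast_zero, zero_mul, pow_zero, mul_one]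
      nlinarith [mul_pos (hm 0) (hn 0), sq_nonneg (k 0 * δ),
        mul_nonneg (mul_pos (hm 0) (hn 0)).le (sq_nonneg (k 0 * δ))]
    | succ i ih =>
      set s := (i : ℝ) * δ with hs
      set t := ((i + 1 : ℕ) : ℝ) * δ with ht
      have hst : t - s = δ := by rw [ht, hs]; push_cast; ring
      have e1 : m s * (1 + k s * δ) ≤ m t := by simpa [hst] using hms s t
      have e2 : n t * (1 - k t * δ) ≤ n s := by
        have := hns t s
        rw [show s - t = -δ by linarith] at this
        linarith
      have hQ : 0 ≤ (1 - (C * δ) ^ 2) ^ i := pow_nonneg hP i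
      rw [pow_succ]
      calc m 0 * n t * ((1 + k 0 * δ) * (1 - k t * δ)
              * ((1 - (C * δ) ^ 2) ^ i * (1 - (C * δ) ^ 2)))
          = (n t * (1 - k t * δ)) * (m 0 * (1 + k 0 * δ) * (1 - (C * δ) ^ 2) ^ i)
              * (1 - (C * δ) ^ 2) := by ring
        _ ≤ n s * (m 0 * (1 + k 0 * δ) * (1 - (C * δ) ^ 2) ^ i)
              * (1 - (k s * δ) ^ 2) := by
            have h1 := (hm 0).le
            have h2 := (hpos 0).le
            have h3 := (hn s).le
            have h4 := hsq s
            gcongr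
        _ = (m 0 * n s * ((1 + k 0 * δ) * (1 - k s * δ) * (1 - (C * δ) ^ 2) ^ i))
              * (1 + k s * δ) := by ring
        _ ≤ (m s * n 0) * (1 + k s * δ) := mul_le_mul_of_nonneg_right ih (hpos s).le
        _ = (m s * (1 + k s * δ)) * n 0 := by ring
        _ ≤ m t * n 0 := mul_le_mul_of_nonneg_right e1 (hn 0).le
  have hlim : Filter.Tendsto (fun N : ℕ => m 0 * n 1 * ((1 + k 0 * (N : ℝ)⁻¹)
      * (1 - k 1 * (N : ℝ)⁻¹) * (1 - C ^ 2 * (N : ℝ)⁻¹))) Filter.atTop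
      (nhds (m 0 * n 1 * ((1 + k 0 * 0) * (1 - k 1 * 0) * (1 - C ^ 2 * 0)))) := by
    have h := tendsto_inv_atTop_nhds_zero_nat (𝕜 := ℝ)
    exact (((h.const_mul _).const_add _).mul ((h.const_mul _).const_sub _)
      |>.mul ((h.const_mul _).const_sub _)).const_mul _
  simp only [mul_zero, add_zero, sub_zero, mul_one] at hlim
  refine le_of_tendsto hlim ?_
  obtain ⟨N₀, hN₀⟩ := exists_nat_gt C
  filter_upwards [Filter.eventually_ge_atTop (max N₀ 1)] with N hN
  have hN1 : (1 : ℝ) ≤ N := by exact_mod_cast (le_max_right _ _).trans hN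
  have hNC : C < N := hN₀.trans_le (by exact_mod_cast (le_max_left _ _).trans hN)
  have hNpos : (0 : ℝ) < N := by linarith
  have hinv : (0 : ℝ) < (N : ℝ)⁻¹ := inv_pos.2 hNpos
  have hCN : C * (N : ℝ)⁻¹ < 1 := by
    rw [← div_eq_mul_inv, div_lt_one hNpos]; exact hNC
  have key := step _ hinv hCN N
  rw [mul_inv_cancel₀ hNpos.ne'] at key
  refine le_trans ?_ key
  have hb : 1 - C ^ 2 * (N : ℝ)⁻¹ ≤ (1 - (C * (N : ℝ)⁻¹) ^ 2) ^ N := by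
    have := one_add_mul_le_pow (a := -(C * (N : ℝ)⁻¹) ^ 2)
      (by nlinarith [mul_nonneg hC hinv.le]) N
    rw [← sub_eq_add_neg] at this
    refine le_trans (le_of_eq ?_) this
    field_simp
    ring
  have hb0 : |k 0 * (N : ℝ)⁻¹| < 1 := by
    rw [abs_mul, abs_of_pos hinv]
    exact (mul_le_mul_of_nonneg_right (hk 0) hinv.le).trans_lt hCN
  have hb1 : |k 1 * (N : ℝ)⁻¹| < 1 := by
    rw [abs_mul, abs_of_pos hinv]
    exact (mul_le_mul_of_nonneg_right (hk 1) hinv.le).trans_lt hCN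
  have h1 : 0 ≤ 1 + k 0 * (N : ℝ)⁻¹ := by linarith [(abs_lt.1 hb0).1]
  have h2 : 0 ≤ 1 - k 1 * (N : ℝ)⁻¹ := by linarith [(abs_lt.1 hb1).2]
  exact mul_le_mul_of_nonneg_left (mul_le_mul_of_nonneg_left hb (mul_nonneg h1 h2))
    (mul_pos (hm 0) (hn 1)).le

lemma exists_norm_eq_one_apply_eq_norm [FiniteDimensional ℝ V] [Nontrivial V] (f : V →L[ℝ] ℝ) :
    ∃ u : V, ‖u‖ = 1 ∧ f u = ‖f‖ := by
  have := FiniteDimensional.proper_real V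
  obtain ⟨u, hu, hmax⟩ := (isCompact_sphere (0 : V) 1).exists_isMaxOn
    (NormedSpace.sphere_nonempty.2 zero_le_one) f.continuous.continuousOn
  have hu1 : ‖u‖ = 1 := by simpa using hu
  have hle : ∀ w : V, ‖w‖ = 1 → f w ≤ f u := fun w hw => hmax (by simpa using hw)
  refine ⟨u, hu1, le_antisymm ?_ ?_⟩
  · simpa [hu1] using (le_abs_self _).trans (f.le_opNorm u)
  · have habs : ∀ w : V, ‖w‖ = 1 → |f w| ≤ f u := fun w hw => abs_le.2
      ⟨by have := hle (-w) (by simpa using hw); rw [map_neg] at this; linarith, hle w hw⟩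
    refine f.opNorm_le_of_unit_norm ((abs_nonneg _).trans (habs u hu1)) habs

/-- A nondegenerate alternating form on a plane, with its Cramer identity. -/
structure IsAreaForm (ω : V →L[ℝ] V →L[ℝ] ℝ) : Prop where
  self_eq_zero : ∀ v, ω v v = 0
  cramer : ∀ u v w, ω v u • w = ω w u • v + ω v w • u
  ne_zero : ∀ v, v ≠ 0 → ω v ≠ 0

lemma exists_isAreaForm (hV : finrank ℝ V = 2) : ∃ ω : V →L[ℝ] V →L[ℝ] ℝ, IsAreaForm ω := by
  have : FiniteDimensional ℝ V := FiniteDimensional.of_finrank_pos (by omega)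
  let B := finBasisOfFinrankEq ℝ V hV
  let f : V →L[ℝ] ℝ := LinearMap.toContinuousLinearMap (B.coord 0)
  let g : V →L[ℝ] ℝ := LinearMap.toContinuousLinearMap (B.coord 1)
  have hfg : ∀ v, v = f v • B 0 + g v • B 1 := fun v => by
    have h := B.sum_repr v
    rw [Fin.sum_univ_two] at h
    exact h.symm
  have hf0 : f (B 0) = 1 := by simp [f]
  have hf1 : f (B 1) = 0 := by simp [f]
  have hg0 : g (B 0) = 0 := by simp [g]
  have hg1 : g (B 1) = 1 := by simp [g]
  have hω : ∀ v w, (f.smulRight g - g.smulRight f) v w = f v * g w - g v * f w := fun v w => by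
    simp
  refine ⟨f.smulRight g - g.smulRight f, fun v => ?_, fun u v w => ?_, fun v hv h => hv ?_⟩
  · rw [hω]; ring
  · simp only [hω]
    rw [hfg u, hfg v, hfg w]
    simp only [map_add, map_smul, hf0, hf1, hg0, hg1, smul_eq_mul]
    module
  · have h0 := hω v (B 0)
    have h1 := hω v (B 1)
    rw [h, hf0, hg0, zero_apply] at h0
    rw [h, hf1, hg1, zero_apply] at h1
    rw [hfg v, show f v = 0 by linarith, show g v = 0 by linarith, zero_smul, zero_smul, add_zero]

namespace IsAreaForm

variable {ω : V →L[ℝ] V →L[ℝ] ℝ}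

lemma neg_swap (hω : IsAreaForm ω) (v w : V) : ω v w = -ω w v := by
  have := hω.self_eq_zero (v + w)
  simp [hω.self_eq_zero] at this
  linarith

/-- The distance from `p` to the line spanned by `v`. -/
lemma sine_eq (hω : IsAreaForm ω) [FiniteDimensional ℝ V] [Nontrivial V] (p : V) {v : V}
    (hv : v ≠ 0) : sine p v = |ω v p| / ‖ω v‖ := by
  have hpos : 0 < ‖ω v‖ := norm_pos_iff.2 (hω.ne_zero v hv)
  obtain ⟨u, hu1, hu⟩ := exists_norm_eq_one_apply_eq_norm (ω v)
  refine le_antisymm ?_ (le_ciInf fun t => ?_)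
  · have hbdd : BddBelow (Set.range fun t : ℝ => ‖p + t • v‖) :=
      ⟨0, by rintro _ ⟨t, rfl⟩; exact norm_nonneg _⟩
    refine (ciInf_le hbdd (-(ω p u / ‖ω v‖))).trans (le_of_eq ?_)
    have hc := hω.cramer u v p
    have : p + -(ω p u / ‖ω v‖) • v = (ω v p / ‖ω v‖) • u := by
      have hp : p = (‖ω v‖)⁻¹ • (ω p u • v + ω v p • u) := by
        rw [← hc, hu, smul_smul, inv_mul_cancel₀ hpos.ne', one_smul]
      nth_rewrite 1 [hp]
      module
    rw [this, norm_smul, hu1, mul_one, Real.norm_eq_abs, abs_div, abs_norm]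
  · rw [div_le_iff₀ hpos, mul_comm]
    simpa [hω.self_eq_zero] using (ω v).le_opNorm (p + t • v)

/-- In a Radon plane the norm and the dual area norm `‖ω ·‖` have a common supporting functional
at every nonzero vector. -/
lemma exists_common_support (hω : IsAreaForm ω) [FiniteDimensional ℝ V] [Nontrivial V]
    (hRadon : ∀ x y : V, BOrth x y → BOrth y x) {y : V} (hy : y ≠ 0) :
    ∃ φ : V →L[ℝ] ℝ, φ y = 1 ∧ ∀ v, ‖y‖ * |φ v| ≤ ‖v‖ ∧ ‖ω y‖ * |φ v| ≤ ‖ω v‖ := by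
  have hpos : 0 < ‖ω y‖ := norm_pos_iff.2 (hω.ne_zero y hy)
  obtain ⟨u, hu1, hu⟩ := exists_norm_eq_one_apply_eq_norm (ω y)
  have horth : BOrth y u := hRadon u y fun t => by
    have h := (le_abs_self _).trans ((ω y).le_opNorm (u + t • y))
    simp only [map_add, map_smul, hω.self_eq_zero, hu, smul_zero, add_zero] at h
    rw [hu1]
    exact le_of_mul_le_mul_left (by simpa using h) hpos
  refine ⟨(‖ω y‖)⁻¹ • ω.flip u, ?_, fun v => ⟨?_, ?_⟩⟩
  · simp [hu, hpos.ne']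
  · have hφ : ((‖ω y‖)⁻¹ • ω.flip u) v = ω v u / ‖ω y‖ := by simp [div_eq_inv_mul]
    rw [hφ]
    set a := ω v u / ‖ω y‖ with ha
    have hv : v = a • y + (ω y v / ‖ω y‖) • u := by
      have hc := hω.cramer u y v
      have hp : v = (‖ω y‖)⁻¹ • (ω v u • y + ω y v • u) := by
        rw [← hc, hu, smul_smul, inv_mul_cancel₀ hpos.ne', one_smul]
      nth_rewrite 1 [hp]
      rw [ha]
      module
    by_cases ha0 : a = 0
    · simp [ha0]
    · have hv' : v = a • (y + (a⁻¹ * (ω y v / ‖ω y‖)) • u) := by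
        rw [smul_add, smul_smul, ← mul_assoc, mul_inv_cancel₀ ha0, one_mul]
        exact hv
      have h := horth (a⁻¹ * (ω y v / ‖ω y‖))
      calc ‖y‖ * |a| = |a| * ‖y‖ := mul_comm _ _
        _ ≤ |a| * ‖y + (a⁻¹ * (ω y v / ‖ω y‖)) • u‖ :=
          mul_le_mul_of_nonneg_left h (abs_nonneg _)
        _ = ‖v‖ := by rw [← Real.norm_eq_abs, ← norm_smul, ← hv']
  · have h := (ω v).le_opNorm u
    rw [hu1, mul_one, Real.norm_eq_abs] at h
    simpa [abs_mul, abs_inv, ← mul_assoc, hpos.ne'] using h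

lemma norm_eq_of_norm_eq (hω : IsAreaForm ω) [FiniteDimensional ℝ V] [Nontrivial V]
    (hRadon : ∀ x y : V, BOrth x y → BOrth y x) {x y : V} (hxy : ω x y ≠ 0) (h : ‖x‖ = ‖y‖) :
    ‖ω x‖ = ‖ω y‖ := by
  have hωd : ∀ t : ℝ, ω (y - x) (x + t • (y - x)) = -ω x y := fun t => by
    rw [map_add, map_smul, hω.self_eq_zero, smul_zero, add_zero, map_sub,
      sub_apply, hω.self_eq_zero, hω.neg_swap y x, sub_zero]
  have hne : ∀ t : ℝ, x + t • (y - x) ≠ 0 := fun t h0 => hxy <| by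
    have := hωd t
    rw [h0, map_zero] at this
    linarith
  have hlow : ∀ t : ℝ, |ω x y| ≤ ‖ω (y - x)‖ * ‖x + t • (y - x)‖ := fun t => by
    have h := (ω (y - x)).le_opNorm (x + t • (y - x))
    rwa [hωd t, norm_neg, Real.norm_eq_abs] at h
  have hxy' : 0 < |ω x y| := abs_pos.2 hxy
  choose φ hφ1 hφ using fun t : ℝ => hω.exists_common_support hRadon (hne t)
  have hφt : ∀ s t : ℝ, φ s (x + t • (y - x)) = 1 + φ s (y - x) * (t - s) := fun s t => by
    have : x + t • (y - x) = (x + s • (y - x)) + (t - s) • (y - x) := by module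
    rw [this, map_add, hφ1, map_smul, smul_eq_mul, mul_comm]
  have hn : ∀ t : ℝ, 0 < ‖x + t • (y - x)‖ := fun t => norm_pos_iff.2 (hne t)
  have hm : ∀ t : ℝ, 0 < ‖ω (x + t • (y - x))‖ := fun t =>
    norm_pos_iff.2 (hω.ne_zero _ (hne t))
  have hk : ∀ t : ℝ, |φ t (y - x)| ≤ ‖y - x‖ * ‖ω (y - x)‖ / |ω x y| := fun t => by
    rw [le_div_iff₀ hxy']
    calc |φ t (y - x)| * |ω x y|
        ≤ |φ t (y - x)| * (‖ω (y - x)‖ * ‖x + t • (y - x)‖) :=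
          mul_le_mul_of_nonneg_left (hlow t) (abs_nonneg _)
      _ = (‖x + t • (y - x)‖ * |φ t (y - x)|) * ‖ω (y - x)‖ := by ring
      _ ≤ ‖y - x‖ * ‖ω (y - x)‖ :=
          mul_le_mul_of_nonneg_right (hφ t _).1 (norm_nonneg _)
  have hns : ∀ s t : ℝ, ‖x + s • (y - x)‖ * (1 + φ s (y - x) * (t - s))
      ≤ ‖x + t • (y - x)‖ := fun s t => by
    rw [← hφt]
    exact (mul_le_mul_of_nonneg_left (le_abs_self _) (norm_nonneg _)).trans (hφ s _).1
  have hms : ∀ s t : ℝ, ‖ω (x + s • (y - x))‖ * (1 + φ s (y - x) * (t - s))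
      ≤ ‖ω (x + t • (y - x))‖ := fun s t => by
    rw [← hφt]
    exact (mul_le_mul_of_nonneg_left (le_abs_self _) (norm_nonneg _)).trans (hφ s _).2
  have h1 := mul_le_mul_of_common_slope hm hn hk hms hns
  have h2 := mul_le_mul_of_common_slope hn hm hk hns hms
  have hy : 0 < ‖y‖ := by simpa using hn 1
  simp only [zero_smul, add_zero, one_smul, add_sub_cancel, h] at h1 h2
  rw [mul_comm, mul_comm ‖y‖] at h2
  exact le_antisymm (le_of_mul_le_mul_right h1 hy) (le_of_mul_le_mul_right (by linarith) hy)

end IsAreaForm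

lemma infDist_line (p q v : V) :
    Metric.infDist p {r : V | ∃ t : ℝ, r = q + t • v} = sine (p - q) v := by
  have hset : {r : V | ∃ t : ℝ, r = q + t • v} = Set.range fun t : ℝ => q + t • v := by
    ext r; simp [eq_comm]
  rw [hset, Metric.infDist_eq_iInf, iInf_range' (fun r => dist p r), sine]
  refine (Equiv.neg ℝ).iInf_congr fun t => ?_
  rw [dist_eq_norm, Equiv.neg_apply]
  congr 1
  module

theorem radon_viviani (hV : finrank ℝ V = 2)
    (hRadon : ∀ x y : V, BOrth x y → BOrth y x)
    (a b c : V) (h1 : ‖b - a‖ = 1) (h2 : ‖c - b‖ = 1) (h3 : ‖a - c‖ = 1)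
    (p : V) (hp : p ∈ interior (convexHull ℝ ({a, b, c} : Set V))) :
    Metric.infDist p {q : V | ∃ t : ℝ, q = a + t • (b - a)} +
      Metric.infDist p {q : V | ∃ t : ℝ, q = b + t • (c - b)} +
      Metric.infDist p {q : V | ∃ t : ℝ, q = c + t • (a - c)} =
    sine (b - a) (c - b) := by
  have : FiniteDimensional ℝ V := FiniteDimensional.of_finrank_pos (by omega)
  have : Nontrivial V := Module.nontrivial_of_finrank_pos (R := ℝ) (by omega)
  obtain ⟨ω, hω⟩ := exists_isAreaForm hV
  obtain ⟨α, β, γ, hα, hβ, hγ, hsum, rfl⟩ : ∃ α β γ : ℝ, 0 ≤ α ∧ 0 ≤ β ∧ 0 ≤ γ ∧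
      α + β + γ = 1 ∧ α • a + β • b + γ • c = p := by
    have hp' := interior_subset hp
    rw [convexHull_insert (Set.insert_nonempty _ _), convexHull_pair,
      convexJoin_singleton_left] at hp'
    simp only [Set.mem_iUnion] at hp'
    obtain ⟨_, ⟨r, s, hr, hs, hrs, rfl⟩, α, δ, hα, hδ, hαδ, rfl⟩ := hp'
    exact ⟨α, δ * r, δ * s, hα, mul_nonneg hδ hr, mul_nonneg hδ hs,
      by linear_combination hαδ + δ * hrs, by module⟩
  obtain ⟨x, hx⟩ : ∃ x, x = b - a := ⟨_, rfl⟩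
  obtain ⟨y, hy⟩ : ∃ y, y = c - b := ⟨_, rfl⟩
  have hz : a - c = -(x + y) := by rw [hx, hy]; abel
  have hp1 : α • a + β • b + γ • c - a = β • x + γ • (x + y) := by
    obtain rfl : α = 1 - β - γ := by linarith
    rw [hx, hy]; module
  have hp2 : α • a + β • b + γ • c - b = γ • y - α • x := by
    obtain rfl : β = 1 - α - γ := by linarith
    rw [hx, hy]; module
  have hp3 : α • a + β • b + γ • c - c = -(α • (x + y) + β • y) := by
    obtain rfl : γ = 1 - α - β := by linarith
    rw [hx, hy]; module
  rw [infDist_line, infDist_line, infDist_line, hp1, hp2, hp3, hz, ← hx, ← hy]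
  rw [← hx] at h1
  rw [← hy] at h2
  rw [hz] at h3
  have hx0 : x ≠ 0 := norm_ne_zero_iff.1 (by rw [h1]; exact one_ne_zero)
  have hy0 : y ≠ 0 := norm_ne_zero_iff.1 (by rw [h2]; exact one_ne_zero)
  have hz0 : -(x + y) ≠ 0 := norm_ne_zero_iff.1 (by rw [h3]; exact one_ne_zero)
  have hxy : ω x y ≠ 0 := fun h0 => by
    obtain ⟨u, -, hu⟩ := exists_norm_eq_one_apply_eq_norm (ω x)
    have hpos : 0 < ‖ω x‖ := norm_pos_iff.2 (hω.ne_zero x hx0)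
    have hc := hω.cramer u x y
    rw [h0, zero_smul, add_zero, hu] at hc
    obtain ⟨l, rfl⟩ : ∃ l : ℝ, y = l • x := ⟨(‖ω x‖)⁻¹ * ω y u, by
      rw [mul_smul, ← hc, smul_smul, inv_mul_cancel₀ hpos.ne', one_smul]⟩
    rw [norm_smul, h1, mul_one, Real.norm_eq_abs] at h2
    rw [norm_neg, show x + l • x = (1 + l) • x by module, norm_smul, h1, mul_one,
      Real.norm_eq_abs] at h3
    rcases abs_eq zero_le_one |>.1 h2 with rfl | rfl <;> norm_num at h3
  have hyz : ω y (-(x + y)) = ω x y := by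
    rw [map_neg, map_add, hω.self_eq_zero, hω.neg_swap y x]; ring
  have e1 : ‖ω x‖ = ‖ω y‖ := hω.norm_eq_of_norm_eq hRadon hxy (h1.trans h2.symm)
  have e2 : ‖ω y‖ = ‖ω (-(x + y))‖ :=
    hω.norm_eq_of_norm_eq hRadon (hyz ▸ hxy) (h2.trans h3.symm)
  have v1 : ω x (β • x + γ • (x + y)) = γ * ω x y := by
    simp [hω.self_eq_zero]
  have v2 : ω y (γ • y - α • x) = α * ω x y := by
    simp [hω.self_eq_zero, hω.neg_swap y x]
  have v3 : ω (-(x + y)) (-(α • (x + y) + β • y)) = β * ω x y := by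
    simp [hω.self_eq_zero, hω.neg_swap y x]
  rw [hω.sine_eq _ hx0, hω.sine_eq _ hy0, hω.sine_eq _ hz0, hω.sine_eq _ hy0, v1, v2, v3,
    ← e2, e1, hω.neg_swap y x, abs_neg, abs_mul, abs_mul, abs_mul, abs_of_nonneg hα,
    abs_of_nonneg hβ, abs_of_nonneg hγ, ← add_div, ← add_div]
  congr 1
  linear_combination |ω x y| * hsum
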